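/- arXiv:0903.0090 — 4 statements merged into one kernel-verified Lean document; each statement's English description precedes it below -/
import Mathlib

section
/- If A is an n×n complex matrix and there exists a normal (n+1)×(n+1) matrix B whose upper-left n×n block is A, then A*A − AA* = xx* − yy* where x is the last column of B restricted to the first n entries and y is the conjugate of the last row restricted to the first n entries. In particular A*A − AA* has rank at most 2. -/
open Matrix

/-- The `(n+1)×(n+1)` block matrix `[[A, x],[y*, z]]`. -/
def completion {n : ℕ} (A : Matrix (Fin n) (Fin n) ℂ) (x y : Fin n → ℂ) (z : ℂ) :
    Matrix (Fin n ⊕ Fin 1) (Fin n ⊕ Fin 1) ℂ :=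
  Matrix.fromBlocks A (Matrix.of fun i (_ : Fin 1) => x i)
    (Matrix.of fun (_ : Fin 1) j => star (y j)) (Matrix.of fun _ _ => z)

theorem stmt0 (n : ℕ) (A : Matrix (Fin n) (Fin n) ℂ) (x y : Fin n → ℂ) (z : ℂ)
    (hB : (completion A x y z)ᴴ * completion A x y z
        = completion A x y z * (completion A x y z)ᴴ) :
    Aᴴ * A - A * Aᴴ = vecMulVec x (star x) - vecMulVec y (star y) ∧
      (Aᴴ * A - A * Aᴴ).rank ≤ 2 := by
  have key : Aᴴ * A - A * Aᴴ = vecMulVec x (star x) - vecMulVec y (star y) := by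
    ext i j
    have h := congrFun (congrFun hB (Sum.inl i)) (Sum.inl j)
    simp only [completion, Matrix.mul_apply, Matrix.conjTranspose_apply, Fintype.sum_sum_type,
      Matrix.fromBlocks_apply₁₁, Matrix.fromBlocks_apply₁₂, Matrix.fromBlocks_apply₂₁,
      Matrix.of_apply, Finset.univ_unique, Finset.sum_singleton, star_star] at h
    simp only [Matrix.sub_apply, Matrix.mul_apply, Matrix.conjTranspose_apply,
      Matrix.vecMulVec_apply, Pi.star_apply]
    linear_combination h
  refine ⟨key, ?_⟩
  have fac : vecMulVec x (star x) - vecMulVec y (star y)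
      = (Matrix.of fun i (k : Fin 2) => ![x i, -y i] k)
        * (Matrix.of fun (k : Fin 2) j => ![star (x j), star (y j)] k) := by
    ext i j
    simp [Matrix.mul_apply, Fin.sum_univ_two, Matrix.vecMulVec_apply, sub_eq_add_neg]
  rw [key, fac]
  exact (Matrix.rank_mul_le_left _ _).trans (Matrix.rank_le_width _)
end

section
/- Let A be an n×n complex matrix. Then A has normal defect 1 if and only if there exist linearly independent vectors x, y ∈ ℂⁿ such that A*A − AA* = xx* − yy* and the four vectors x, y, A*x, Ay are linearly dependent. -/
open Matrix

open scoped InnerProductSpace ComplexConjugate in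
lemma abs_aux {E : Type*} [NormedAddCommGroup E] [InnerProductSpace ℂ E]
    (x y u v : E) (hli : LinearIndependent ℂ ![x, y])
    (hs : ⟪x, x⟫_ℂ = ⟪y, y⟫_ℂ) (h1 : ⟪x, u⟫_ℂ = conj ⟪y, v⟫_ℂ)
    (h2 : ⟪y, u⟫_ℂ = conj ⟪x, v⟫_ℂ) (h3 : ⟪u, u⟫_ℂ = ⟪v, v⟫_ℂ)
    (hd : ¬ LinearIndependent ℂ ![x, y, u, v]) :
    ∃ w c : ℂ, w * conj w = 1 ∧ u + c • w • y = w • v + conj c • x := by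
  obtain ⟨s, hsx⟩ : ∃ s, s = ⟪x, x⟫_ℂ := ⟨_, rfl⟩
  obtain ⟨r, hr⟩ : ∃ r, r = ⟪x, y⟫_ℂ := ⟨_, rfl⟩
  have hsy : ⟪y, y⟫_ℂ = s := by rw [hsx, hs]
  have hr' : ⟪y, x⟫_ℂ = conj r := by rw [hr, inner_conj_symm]
  have hsc : conj s = s := by rw [hsx, inner_conj_symm]
  have hpair := LinearIndependent.pair_iff.1 hli
  have hx0 : x ≠ 0 := by
    rintro rfl
    have := hpair 1 0 (by simp)
    simp at this
  have hs0 : s ≠ 0 := by rw [hsx]; simpa using hx0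
  have hD : s * s - r * conj r ≠ 0 := by
    intro h
    have : ⟪s • y - r • x, s • y - r • x⟫_ℂ = 0 := by
      simp only [inner_sub_left, inner_sub_right, inner_smul_left, inner_smul_right,
        ← hsx, ← hr, hsy, hr', hsc]
      linear_combination s * h
    rw [inner_self_eq_zero] at this
    have := hpair (-r) s (by rw [← this]; module)
    exact hs0 this.2
  have hDc : conj (s * s - r * conj r) = s * s - r * conj r := by
    simp [hsc, mul_comm]
  -- a vector of the span orthogonal to x, y vanishes
  have hperp : ∀ α β : ℂ, ⟪x, α • x + β • y⟫_ℂ = 0 → ⟪y, α • x + β • y⟫_ℂ = 0 →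
      α • x + β • y = 0 := by
    intro α β ha hb
    rw [← inner_self_eq_zero (𝕜 := ℂ)]
    rw [inner_add_left, inner_smul_left, inner_smul_left, ha, hb]; simp
  obtain ⟨p, hp⟩ : ∃ p, p = ⟪x, u⟫_ℂ := ⟨_, rfl⟩
  obtain ⟨q, hq⟩ : ∃ q, q = ⟪y, u⟫_ℂ := ⟨_, rfl⟩
  have hyv : ⟪y, v⟫_ℂ = conj p := by rw [hp, h1]; simp
  have hxv : ⟪x, v⟫_ℂ = conj q := by rw [hq, h2]; simp
  have hux : ⟪u, x⟫_ℂ = conj p := by rw [hp, inner_conj_symm]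
  have huy : ⟪u, y⟫_ℂ = conj q := by rw [hq, inner_conj_symm]
  have hvx : ⟪v, x⟫_ℂ = q := by rw [← inner_conj_symm, hxv]; simp
  have hvy : ⟪v, y⟫_ℂ = p := by rw [← inner_conj_symm, hyv]; simp
  obtain ⟨a, b, hab1, hab2⟩ : ∃ a b : ℂ, a * s + b * r = p ∧ a * conj r + b * s = q := by
    refine ⟨(p * s - q * r) / (s * s - r * conj r),
      (q * s - p * conj r) / (s * s - r * conj r), ?_, ?_⟩
    · rw [div_mul_eq_mul_div, div_mul_eq_mul_div, ← add_div, div_eq_iff hD]; ring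
    · rw [div_mul_eq_mul_div, div_mul_eq_mul_div, ← add_div, div_eq_iff hD]; ring
  have hab1' := congrArg conj hab1
  have hab2' := congrArg conj hab2
  simp only [map_add, map_mul, hsc, Complex.conj_conj] at hab1' hab2'
  obtain ⟨e, he⟩ : ∃ e, e = u - (a • x + b • y) := ⟨_, rfl⟩
  obtain ⟨f, hf⟩ : ∃ f, f = v - (conj b • x + conj a • y) := ⟨_, rfl⟩
  have hxe : ⟪x, e⟫_ℂ = 0 := by
    rw [he]; simp only [inner_sub_right, inner_add_right, inner_smul_right, ← hsx, ← hr, ← hp]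
    linear_combination -hab1
  have hye : ⟪y, e⟫_ℂ = 0 := by
    rw [he]; simp only [inner_sub_right, inner_add_right, inner_smul_right, hsy, hr', ← hq]
    linear_combination -hab2
  have hxf : ⟪x, f⟫_ℂ = 0 := by
    rw [hf]; simp only [inner_sub_right, inner_add_right, inner_smul_right, ← hsx, ← hr, hxv]
    linear_combination -hab2'
  have hyf : ⟪y, f⟫_ℂ = 0 := by
    rw [hf]; simp only [inner_sub_right, inner_add_right, inner_smul_right, hsy, hr', hyv]
    linear_combination -hab1'
  have hee : ⟪e, e⟫_ℂ = ⟪f, f⟫_ℂ := by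
    have e1 : ⟪e, e⟫_ℂ = ⟪u, e⟫_ℂ := by
      conv_lhs => rw [he, inner_sub_left, inner_add_left, inner_smul_left, inner_smul_left,
        ← he, hxe, hye]
      simp
    have f1 : ⟪f, f⟫_ℂ = ⟪v, f⟫_ℂ := by
      conv_lhs => rw [hf, inner_sub_left, inner_add_left, inner_smul_left, inner_smul_left,
        ← hf, hxf, hyf]
      simp
    rw [e1, f1, he, hf]
    simp only [inner_sub_right, inner_add_right, inner_smul_right, hux, huy, hvx, hvy, h3]
    rw [← hab1, ← hab2]
    simp only [map_add, map_mul, hsc, Complex.conj_conj]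
    ring
  -- the unimodular factor
  obtain ⟨w, hw, hew⟩ : ∃ w : ℂ, w * conj w = 1 ∧ e = w • f := by
    rw [Fintype.not_linearIndependent_iff] at hd
    obtain ⟨g, hg, i, hi⟩ := hd
    simp only [Fin.sum_univ_four, Matrix.cons_val] at hg
    obtain ⟨γ, hγ⟩ : ∃ γ, γ = g 2 := ⟨_, rfl⟩
    obtain ⟨δ, hδ⟩ : ∃ δ, δ = g 3 := ⟨_, rfl⟩
    rw [← hγ, ← hδ] at hg
    have hgd : ¬ (γ = 0 ∧ δ = 0) := by
      rintro ⟨h, h'⟩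
      rw [h, h'] at hg
      have := hpair (g 0) (g 1) (by simpa using hg)
      fin_cases i
      · exact hi this.1
      · exact hi this.2
      · exact hi (hγ ▸ h)
      · exact hi (hδ ▸ h')
    have key : γ • e + δ • f = 0 := by
      have h0 : γ • e + δ • f = (-(g 0) - γ * a - δ * conj b) • x
          + (-(g 1) - γ * b - δ * conj a) • y := by
        have : γ • e + δ • f = (g 0 • x + g 1 • y + γ • u + δ • v) +
          ((-(g 0) - γ * a - δ * conj b) • x
          + (-(g 1) - γ * b - δ * conj a) • y) := by rw [he, hf]; module
        rw [this, hg, zero_add]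
      rw [h0]
      apply hperp
      · rw [← h0]; simp [inner_add_right, inner_smul_right, hxe, hxf]
      · rw [← h0]; simp [inner_add_right, inner_smul_right, hye, hyf]
    have hg2 : γ • e = (-δ) • f := by
      rw [neg_smul]; exact eq_neg_of_add_eq_zero_left key
    have hn : γ * conj γ * ⟪f, f⟫_ℂ = δ * conj δ * ⟪f, f⟫_ℂ := by
      have : ⟪γ • e, γ • e⟫_ℂ = ⟪(-δ) • f, (-δ) • f⟫_ℂ := by rw [hg2]
      simp only [inner_smul_left, inner_smul_right, hee, map_neg] at this
      linear_combination this
    by_cases hf0 : f = 0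
    · refine ⟨1, by simp, ?_⟩
      have : ⟪e, e⟫_ℂ = 0 := by rw [hee, hf0]; simp
      rw [inner_self_eq_zero] at this
      rw [this, hf0]; simp
    · have hff : ⟪f, f⟫_ℂ ≠ 0 := by simpa using hf0
      have hn' := mul_right_cancel₀ hff hn
      have hγ0 : γ ≠ 0 := by
        intro h
        refine hgd ⟨h, ?_⟩
        rw [h] at hn'
        simpa using hn'.symm
      have hγc : conj γ ≠ 0 := by simpa using hγ0
      refine ⟨-δ / γ, ?_, ?_⟩
      · rw [map_div₀, map_neg]
        field_simp
        linear_combination -hn'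
      · rw [div_eq_inv_mul, mul_smul, ← hg2, smul_smul, inv_mul_cancel₀ hγ0, one_smul]
  -- u - w v in the span
  obtain ⟨α, hα⟩ : ∃ α, α = a - w * conj b := ⟨_, rfl⟩
  obtain ⟨β, hβ⟩ : ∃ β, β = b - w * conj a := ⟨_, rfl⟩
  have hrel : u = w • v + α • x + β • y := by
    have : u = e + (a • x + b • y) := by rw [he]; abel
    rw [this, hew, hf, hα, hβ]; module
  have hβ2 : β = - w * conj α := by
    rw [hα, hβ]; simp only [map_sub, map_mul, Complex.conj_conj]
    linear_combination (-b) * hw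
  refine ⟨w, conj α, hw, ?_⟩
  rw [hrel, hβ2, Complex.conj_conj]
  module

open scoped ComplexOrder in
lemma dot_aux {n : ℕ} (v : Fin n → ℂ) : star v ⬝ᵥ v = 0 ↔ v = 0 :=
  dotProduct_star_self_eq_zero

lemma normal_iff_aux {n : ℕ} (A : Matrix (Fin n) (Fin n) ℂ) (x y : Fin n → ℂ) (c : ℂ)
    (B : Matrix (Fin n ⊕ Fin 1) (Fin n ⊕ Fin 1) ℂ)
    (hB : B = fromBlocks A (of fun i _ => x i) (of fun _ j => star (y j)) (of fun _ _ => c)) :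
    Bᴴ * B = B * Bᴴ ↔
      (Aᴴ * A - A * Aᴴ = vecMulVec x (star x) - vecMulVec y (star y) ∧
       Aᴴ *ᵥ x + c • y = A *ᵥ y + star c • x ∧ star x ⬝ᵥ x = star y ⬝ᵥ y) := by
  have e11 : (of fun (_ : Fin 1) j => star (y j))ᴴ * (of fun (_ : Fin 1) j => star (y j))
      = vecMulVec y (star y) := by
    ext i j; simp [Matrix.mul_apply, vecMulVec_apply]
  have e11' : (of fun i (_ : Fin 1) => x i) * (of fun i (_ : Fin 1) => x i)ᴴ
      = vecMulVec x (star x) := by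
    ext i j; simp [Matrix.mul_apply, vecMulVec_apply]
  have e12 : (Aᴴ * (of fun i (_ : Fin 1) => x i)
      + (of fun (_ : Fin 1) j => star (y j))ᴴ * (of fun (_ _ : Fin 1) => c))
      = of fun i (_ : Fin 1) => (Aᴴ *ᵥ x + c • y) i := by
    ext i j; simp [Matrix.mul_apply, mulVec, dotProduct, mul_comm]
  have e12' : (A * (of fun (_ : Fin 1) j => star (y j))ᴴ
      + (of fun i (_ : Fin 1) => x i) * (of fun (_ _ : Fin 1) => c)ᴴ)
      = of fun i (_ : Fin 1) => (A *ᵥ y + star c • x) i := by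
    ext i j; simp [Matrix.mul_apply, mulVec, dotProduct, mul_comm]
  have e21 : ((of fun i (_ : Fin 1) => x i)ᴴ * A
      + (of fun (_ _ : Fin 1) => c)ᴴ * (of fun (_ : Fin 1) j => star (y j)))
      = (of fun i (_ : Fin 1) => (Aᴴ *ᵥ x + c • y) i)ᴴ := by
    rw [← e12]; simp [conjTranspose_add, conjTranspose_mul]
  have e21' : ((of fun (_ : Fin 1) j => star (y j)) * Aᴴ
      + (of fun (_ _ : Fin 1) => c) * (of fun i (_ : Fin 1) => x i)ᴴ)
      = (of fun i (_ : Fin 1) => (A *ᵥ y + star c • x) i)ᴴ := by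
    rw [← e12']; simp [conjTranspose_add, conjTranspose_mul]
  have e22 : ((of fun i (_ : Fin 1) => x i)ᴴ * (of fun i (_ : Fin 1) => x i)
      + (of fun (_ _ : Fin 1) => c)ᴴ * (of fun (_ _ : Fin 1) => c))
      = (of fun (_ _ : Fin 1) => star x ⬝ᵥ x + star c * c) := by
    ext i j; simp [Matrix.mul_apply, dotProduct]
  have e22' : ((of fun (_ : Fin 1) j => star (y j)) * (of fun (_ : Fin 1) j => star (y j))ᴴ
      + (of fun (_ _ : Fin 1) => c) * (of fun (_ _ : Fin 1) => c)ᴴ)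
      = (of fun (_ _ : Fin 1) => star y ⬝ᵥ y + star c * c) := by
    ext i j; simp [Matrix.mul_apply, dotProduct, mul_comm]
  rw [hB, fromBlocks_conjTranspose, fromBlocks_multiply, fromBlocks_multiply, fromBlocks_inj,
    e11, e11', e12, e12', e21, e21', e22, e22']
  constructor
  · rintro ⟨h1, h2, -, h4⟩
    refine ⟨?_, ?_, ?_⟩
    · rw [sub_eq_sub_iff_add_eq_add, h1, add_comm]
    · funext i
      simpa using congrFun (congrFun h2 i) 0
    · simpa using congrFun (congrFun h4 0) 0
  · rintro ⟨h1, h2, h3⟩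
    rw [sub_eq_sub_iff_add_eq_add] at h1
    refine ⟨?_, ?_, ?_, ?_⟩
    · rw [h1, add_comm]
    · rw [h2]
    · rw [h2]
    · rw [h3]

theorem stmt8 (n : ℕ) (A : Matrix (Fin n) (Fin n) ℂ) :
    ((¬ Aᴴ * A = A * Aᴴ) ∧
      ∃ B : Matrix (Fin n ⊕ Fin 1) (Fin n ⊕ Fin 1) ℂ,
        Bᴴ * B = B * Bᴴ ∧ B.toBlocks₁₁ = A) ↔
    ∃ x y : Fin n → ℂ, LinearIndependent ℂ ![x, y] ∧
      Aᴴ * A - A * Aᴴ = vecMulVec x (star x) - vecMulVec y (star y) ∧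
      ¬ LinearIndependent ℂ ![x, y, Aᴴ *ᵥ x, A *ᵥ y] := by
  constructor
  · rintro ⟨hA, B, hB, hBA⟩
    obtain ⟨x, hx⟩ : ∃ x : Fin n → ℂ, x = fun i => B (Sum.inl i) (Sum.inr 0) := ⟨_, rfl⟩
    obtain ⟨y, hy⟩ : ∃ y : Fin n → ℂ, y = fun i => star (B (Sum.inr 0) (Sum.inl i)) := ⟨_, rfl⟩
    obtain ⟨c, hc⟩ : ∃ c : ℂ, c = B (Sum.inr 0) (Sum.inr 0) := ⟨_, rfl⟩
    have hBe : B = fromBlocks A (of fun i _ => x i) (of fun _ j => star (y j))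
        (of fun _ _ => c) := by
      rw [← fromBlocks_toBlocks B, hBA, fromBlocks_inj]
      refine ⟨rfl, ?_, ?_, ?_⟩
      · ext i j; simp [toBlocks₁₂, hx, Subsingleton.elim j 0]
      · ext i j; simp [toBlocks₂₁, hy, Subsingleton.elim i 0]
      · ext i j; simp [toBlocks₂₂, hc, Subsingleton.elim i 0, Subsingleton.elim j 0]
    obtain ⟨h1, h2, h3⟩ := (normal_iff_aux A x y c B hBe).1 hB
    refine ⟨x, y, ?_, h1, ?_⟩
    · by_contra hli
      apply hA
      rw [← sub_eq_zero, h1]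
      have hy0 : y ≠ 0 := by
        rintro rfl
        have : x = 0 := by rw [← dot_aux, h3]; simp
        subst this
        apply hA
        rw [← sub_eq_zero, h1]; simp
      have : ∃ t : ℂ, x = t • y := by
        rw [LinearIndependent.pair_iff] at hli
        push Not at hli
        obtain ⟨s, t, hst, hne⟩ := hli
        have hs : s ≠ 0 := by
          intro h
          have ht := hne h
          rw [h] at hst
          simp [ht, hy0] at hst
        refine ⟨-t / s, ?_⟩
        have : s • x = (-t) • y := by rw [neg_smul]; exact eq_neg_of_add_eq_zero_left hst
        rw [div_eq_inv_mul, mul_smul, ← this, smul_smul, inv_mul_cancel₀ hs, one_smul]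
      obtain ⟨t, rfl⟩ := this
      have hyy : star y ⬝ᵥ y ≠ 0 := fun h => hy0 ((dot_aux y).1 h)
      have ht : star t * t = 1 := by
        apply mul_right_cancel₀ hyy
        rw [one_mul]
        simp only [star_smul, smul_dotProduct, dotProduct_smul, smul_eq_mul] at h3
        linear_combination h3
      ext i j
      simp only [Matrix.sub_apply, vecMulVec_apply, Pi.smul_apply, Pi.star_apply, smul_eq_mul,
        star_mul', Matrix.zero_apply]
      linear_combination (y i * star (y j)) * ht
    · rw [Fintype.not_linearIndependent_iff]
      refine ⟨![-star c, c, 1, -1], ?_, 2, by simp⟩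
      simp only [Fin.sum_univ_four, Matrix.cons_val]
      have : Aᴴ *ᵥ x = A *ᵥ y + star c • x - c • y := by rw [← h2]; abel
      rw [this]; module
  · rintro ⟨x, y, hli, hC, hd⟩
    have htr : ∀ M : Matrix (Fin n) (Fin n) ℂ, trace (M * (Aᴴ * A - A * Aᴴ)) =
        star x ⬝ᵥ M *ᵥ x - star y ⬝ᵥ M *ᵥ y := by
      intro M
      rw [hC, Matrix.mul_sub, trace_sub, mul_vecMulVec, mul_vecMulVec, trace_vecMulVec,
        trace_vecMulVec, dotProduct_comm, dotProduct_comm (M *ᵥ y)]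
    have hs : star x ⬝ᵥ x = star y ⬝ᵥ y := by
      have := htr 1
      rw [Matrix.one_mul, trace_sub, trace_mul_comm, sub_self, one_mulVec, one_mulVec] at this
      exact (sub_eq_zero.1 this.symm)
    have hp : star x ⬝ᵥ A *ᵥ x = star y ⬝ᵥ A *ᵥ y := by
      have := htr A
      rw [Matrix.mul_sub, trace_sub, trace_mul_comm A (A * Aᴴ), ← Matrix.mul_assoc,
        Matrix.mul_assoc A Aᴴ A, sub_self] at this
      exact (sub_eq_zero.1 this.symm)
    have hPR : star x ⬝ᵥ (Aᴴ * A + A * Aᴴ) *ᵥ x = star y ⬝ᵥ (Aᴴ * A + A * Aᴴ) *ᵥ y := by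
      have := htr (Aᴴ * A + A * Aᴴ)
      have h0 : trace ((Aᴴ * A + A * Aᴴ) * (Aᴴ * A - A * Aᴴ)) = 0 := by
        rw [Matrix.mul_sub, Matrix.add_mul, Matrix.add_mul, trace_sub, trace_add, trace_add,
          trace_mul_comm (A * Aᴴ) (Aᴴ * A)]
        have : trace (Aᴴ * A * (Aᴴ * A)) = trace (A * Aᴴ * (A * Aᴴ)) := by
          rw [Matrix.mul_assoc, trace_mul_comm]
          simp only [Matrix.mul_assoc]
        rw [this]; ring
      rw [h0] at this
      exact (sub_eq_zero.1 this.symm)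
    have hq : ∀ z, star z ⬝ᵥ (Aᴴ * A) *ᵥ z - star z ⬝ᵥ (A * Aᴴ) *ᵥ z =
        (star x ⬝ᵥ z) * (star z ⬝ᵥ x) - (star y ⬝ᵥ z) * (star z ⬝ᵥ y) := by
      intro z
      rw [← dotProduct_sub, ← sub_mulVec, hC, sub_mulVec, dotProduct_sub, vecMulVec_mulVec,
        vecMulVec_mulVec]
      simp [dotProduct_smul, mul_comm]
    have hN : star x ⬝ᵥ (A * Aᴴ) *ᵥ x = star y ⬝ᵥ (Aᴴ * A) *ᵥ y := by
      have q1 := hq x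
      have q2 := hq y
      rw [add_mulVec, add_mulVec, dotProduct_add, dotProduct_add] at hPR
      rw [← hs] at q2
      rw [hs] at q1
      rw [hs] at q2
      linear_combination (1/2 : ℂ) * hPR - (1/2 : ℂ) * q1 - (1/2 : ℂ) * q2
    have hadj : ∀ (M : Matrix (Fin n) (Fin n) ℂ) (u v : Fin n → ℂ),
        star (M *ᵥ u) ⬝ᵥ v = star u ⬝ᵥ Mᴴ *ᵥ v := by
      intro M u v
      rw [star_mulVec, dotProduct_mulVec]
    have hconj : ∀ u v : Fin n → ℂ, star (star u ⬝ᵥ v) = star v ⬝ᵥ u := by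
      intro u v
      rw [← star_dotProduct_star, star_star, dotProduct_comm] <;> skip
    have hinn : ∀ u v : Fin n → ℂ, inner ℂ (WithLp.toLp 2 u) (WithLp.toLp 2 v)
        = star u ⬝ᵥ v := by
      intro u v
      rw [EuclideanSpace.inner_toLp_toLp, dotProduct_comm]
    have hli' : LinearIndependent ℂ ![WithLp.toLp 2 x, WithLp.toLp 2 y] := by
      have := hli.map' (WithLp.linearEquiv 2 ℂ (Fin n → ℂ)).symm.toLinearMap
        (LinearEquiv.ker _)
      have heq : ![WithLp.toLp 2 x, WithLp.toLp 2 y] = (WithLp.linearEquiv 2 ℂ (Fin n → ℂ)).symm.toLinearMap ∘ ![x, y] := by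
        funext i; fin_cases i <;> rfl
      rw [heq]
      exact this
    have hd' : ¬ LinearIndependent ℂ ![WithLp.toLp 2 x, WithLp.toLp 2 y,
        WithLp.toLp 2 (Aᴴ *ᵥ x), WithLp.toLp 2 (A *ᵥ y)] := by
      intro h
      apply hd
      have := h.map' (WithLp.linearEquiv 2 ℂ (Fin n → ℂ)).toLinearMap
        (LinearEquiv.ker _)
      have heq : ![x, y, Aᴴ *ᵥ x, A *ᵥ y] = (WithLp.linearEquiv 2 ℂ (Fin n → ℂ)).toLinearMap ∘ ![WithLp.toLp 2 x, WithLp.toLp 2 y,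
          WithLp.toLp 2 (Aᴴ *ᵥ x), WithLp.toLp 2 (A *ᵥ y)] := by
        funext i; fin_cases i <;> rfl
      rw [heq]
      exact this
    obtain ⟨w, c, hw, hrel⟩ := abs_aux (WithLp.toLp 2 x) (WithLp.toLp 2 y)
      (WithLp.toLp 2 (Aᴴ *ᵥ x)) (WithLp.toLp 2 (A *ᵥ y)) hli'
      (by rw [hinn, hinn, hs])
      (by rw [hinn, hinn, ← hp, starRingEnd_apply, hconj, hadj])
      (by rw [hinn, hinn, starRingEnd_apply, hconj, hadj])
      (by rw [hinn, hinn, hadj, hadj, mulVec_mulVec, mulVec_mulVec, conjTranspose_conjTranspose, hN])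
      hd'
    have hrel' : Aᴴ *ᵥ x + c • w • y = A *ᵥ (w • y) + star c • x := by
      have := congrArg (WithLp.ofLp) hrel
      rw [mulVec_smul]
      simpa using this
    have hw' : w * star w = 1 := hw
    have hvv : vecMulVec (w • y) (star (w • y)) = vecMulVec y (star y) := by
      ext i j
      simp only [vecMulVec_apply, Pi.smul_apply, Pi.star_apply, smul_eq_mul, star_mul']
      linear_combination (y i * star (y j)) * hw'
    have hss : star (w • y) ⬝ᵥ (w • y) = star y ⬝ᵥ y := by
      simp only [star_smul, smul_dotProduct, dotProduct_smul, smul_eq_mul]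
      linear_combination (star y ⬝ᵥ y) * hw'
    refine ⟨?_, _, (normal_iff_aux A x (w • y) c _ rfl).2
      ⟨by rw [hvv, hC], hrel', by rw [hss, hs]⟩, by simp⟩
    intro hA
    rw [hA, sub_self] at hC
    -- normality would force x to be a combination of y
    have h0 := congrArg (fun M => M *ᵥ x) hC.symm
    simp only [sub_mulVec, vecMulVec_mulVec, zero_mulVec, op_smul_eq_smul] at h0
    have hpair := LinearIndependent.pair_iff.1 hli (star x ⬝ᵥ x) (-(star y ⬝ᵥ x))
      (by rw [← h0]; module)
    have hx0 := (dot_aux x).1 hpair.1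
    have := LinearIndependent.pair_iff.1 hli 1 0 (by simp [hx0])
    simp at this
end

section
/- Every non-normal 3×3 complex matrix A with rank(A*A − AA*) = 2 has normal defect one, i.e., admits a normal 4×4 completion. Consequently, for every 3×3 complex matrix A, the normal defect of A equals max{i₊(A*A−AA*), i₋(A*A−AA*)}, the larger of the numbers of positive and negative eigenvalues of A*A−AA*. -/
open Matrix

namespace NormalDefect

/-- A completion of size `3 + p` from block data. -/
lemma completion_of_blocks {p : ℕ} (A : Matrix (Fin 3) (Fin 3) ℂ)
    (N : Matrix (Fin 3 ⊕ Fin p) (Fin 3 ⊕ Fin p) ℂ) (hN : Nᴴ * N = N * Nᴴ)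
    (hA : ∀ i j, N (Sum.inl i) (Sum.inl j) = A i j) :
    ∃ B : Matrix (Fin (3 + p)) (Fin (3 + p)) ℂ, Bᴴ * B = B * Bᴴ ∧
        ∀ i j : Fin 3, B (Fin.castLE (Nat.le_add_right 3 p) i)
          (Fin.castLE (Nat.le_add_right 3 p) j) = A i j := by
  refine ⟨N.submatrix finSumFinEquiv.symm finSumFinEquiv.symm, ?_, ?_⟩
  · rw [conjTranspose_submatrix, submatrix_mul_equiv, submatrix_mul_equiv, hN]
  · intro i j
    have h : ∀ i : Fin 3, (finSumFinEquiv (m := 3) (n := p)).symm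
        (Fin.castLE (Nat.le_add_right 3 p) i) = Sum.inl i := fun i =>
      finSumFinEquiv_symm_apply_castAdd i
    rw [submatrix_apply, h, h, hA]

/-- Bordering data for a normal completion by one row and column. -/
def Bord (A : Matrix (Fin 3) (Fin 3) ℂ) : Prop :=
  ∃ (b c : Matrix (Fin 3) (Fin 1) ℂ) (d : ℂ),
    Aᴴ * A - A * Aᴴ = b * bᴴ - c * cᴴ ∧ Aᴴ * b + d • c = A * c + star d • b ∧
    bᴴ * b = cᴴ * c

lemma Bord.completion {A : Matrix (Fin 3) (Fin 3) ℂ} (h : Bord A) :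
    ∃ B : Matrix (Fin (3 + 1)) (Fin (3 + 1)) ℂ, Bᴴ * B = B * Bᴴ ∧
        ∀ i j : Fin 3, B (Fin.castLE (Nat.le_add_right 3 1) i)
          (Fin.castLE (Nat.le_add_right 3 1) j) = A i j := by
  obtain ⟨b, c, d, h1, h2, h3⟩ := h
  refine completion_of_blocks A
    (fromBlocks A b cᴴ (d • (1 : Matrix (Fin 1) (Fin 1) ℂ))) ?_ (fun i j => rfl)
  rw [fromBlocks_conjTranspose, fromBlocks_multiply, fromBlocks_multiply]
  have h2' := congrArg conjTranspose h2
  simp only [conjTranspose_add, conjTranspose_mul, conjTranspose_smul,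
    conjTranspose_conjTranspose, star_star] at h2'
  congr 1
  · rw [conjTranspose_conjTranspose, ← sub_eq_zero]
    rw [← sub_eq_zero] at h1
    rw [← h1]; abel
  · simpa using h2
  · simpa using h2'
  · rw [conjTranspose_conjTranspose, h3]
    simp [smul_smul, mul_comm]

lemma Bord.conj {A U : Matrix (Fin 3) (Fin 3) ℂ} (hU : Uᴴ * U = 1)
    (h : Bord (Uᴴ * A * U)) : Bord A := by
  have hU' : U * Uᴴ = 1 := mul_eq_one_comm.mp hU
  obtain ⟨b, c, d, h1, h2, h3⟩ := h
  have key : ∀ M : Matrix (Fin 3) (Fin 3) ℂ, U * (Uᴴ * M * U) * Uᴴ = M := fun M => by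
    calc U * (Uᴴ * M * U) * Uᴴ = (U * Uᴴ) * M * (U * Uᴴ) := by simp only [Matrix.mul_assoc]
      _ = M := by rw [hU']; simp
  have e1 : (Uᴴ * A * U)ᴴ * (Uᴴ * A * U) = Uᴴ * (Aᴴ * A) * U := by
    simp only [conjTranspose_mul, conjTranspose_conjTranspose]
    calc _ = Uᴴ * Aᴴ * (U * Uᴴ) * A * U := by simp only [Matrix.mul_assoc]
      _ = _ := by rw [hU']; simp [Matrix.mul_assoc]
  have e2 : (Uᴴ * A * U) * (Uᴴ * A * U)ᴴ = Uᴴ * (A * Aᴴ) * U := by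
    simp only [conjTranspose_mul, conjTranspose_conjTranspose]
    calc _ = Uᴴ * A * (U * Uᴴ) * Aᴴ * U := by simp only [Matrix.mul_assoc]
      _ = _ := by rw [hU']; simp [Matrix.mul_assoc]
  refine ⟨U * b, U * c, d, ?_, ?_, ?_⟩
  · have := congrArg (fun M => U * M * Uᴴ) h1
    simp only [e1, e2, Matrix.mul_sub, Matrix.sub_mul, key] at this
    rw [this]
    simp only [conjTranspose_mul, Matrix.mul_assoc]
  · have := congrArg (fun M => U * M) h2
    simp only [conjTranspose_mul, conjTranspose_conjTranspose, Matrix.mul_add,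
      Matrix.mul_smul] at this
    have f : ∀ (M : Matrix (Fin 3) (Fin 3) ℂ) (x : Matrix (Fin 3) (Fin 1) ℂ),
        U * (Uᴴ * M * U * x) = M * (U * x) := fun M x => by
      calc _ = (U * Uᴴ) * M * (U * x) := by simp only [Matrix.mul_assoc]
        _ = _ := by rw [hU']; simp
    rw [← Matrix.mul_assoc Uᴴ Aᴴ U, f, f] at this
    exact this
  · simp only [conjTranspose_mul]
    calc _ = bᴴ * (Uᴴ * U) * b := by simp only [Matrix.mul_assoc]
      _ = cᴴ * (Uᴴ * U) * c := by rw [hU]; simpa using h3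
      _ = _ := by simp only [Matrix.mul_assoc]

lemma exists_phase (p s : ℂ) (h : star p * p = star s * s) :
    ∃ t : ℂ, star t * t = 1 ∧ star p = t * s := by
  by_cases hs : s = 0
  · subst hs
    refine ⟨1, by simp, ?_⟩
    have : p = 0 := by simpa using h
    simp [this]
  · refine ⟨star p / s, ?_, by field_simp⟩
    have hs' : star s ≠ 0 := by simpa using hs
    rw [star_div₀, star_star]
    field_simp
    linear_combination h

lemma trace_zero1 (A : Matrix (Fin 3) (Fin 3) ℂ) :
    ((Aᴴ * A - A * Aᴴ) * A).trace = 0 := by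
  rw [Matrix.sub_mul, trace_sub, Matrix.trace_mul_cycle A Aᴴ A,
    Matrix.trace_mul_comm (A * A) Aᴴ, Matrix.mul_assoc, sub_self]

lemma trace_zero2 (A : Matrix (Fin 3) (Fin 3) ℂ) :
    ((Aᴴ * A - A * Aᴴ) * (A * A)).trace = 0 := by
  rw [Matrix.sub_mul, trace_sub, Matrix.trace_mul_cycle A Aᴴ (A * A),
    Matrix.trace_mul_comm (A * A * A) Aᴴ, sub_eq_zero]
  simp only [Matrix.mul_assoc]

lemma bord_diag (A : Matrix (Fin 3) (Fin 3) ℂ) (l : ℝ) (hl : 0 < l)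
    (h : Aᴴ * A - A * Aᴴ = diagonal ![(l : ℂ), -(l : ℂ), 0]) : Bord A := by
  have hl0 : (l : ℂ) ≠ 0 := by exact_mod_cast hl.ne'
  have t1 := trace_zero1 A
  have t2 := trace_zero2 A
  have h22 := congrFun (congrFun h 2) 2
  rw [h] at t1 t2
  simp [trace, Fin.sum_univ_three, Matrix.mul_apply] at t1 t2
  simp [Fin.sum_univ_three, Matrix.mul_apply] at h22
  have x : A 0 0 = A 1 1 := by
    apply mul_left_cancel₀ hl0; linear_combination t1
  have y : A 0 2 * A 2 0 = A 1 2 * A 2 1 := by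
    apply mul_left_cancel₀ hl0
    rw [x] at t2
    linear_combination t2
  have ns : Complex.normSq (A 0 2) = Complex.normSq (A 2 1) := by
    have hy := congrArg Complex.normSq y
    rw [map_mul, map_mul] at hy
    have hz : Complex.normSq (A 0 2) + Complex.normSq (A 1 2)
        = Complex.normSq (A 2 0) + Complex.normSq (A 2 1) := by
      have : ((Complex.normSq (A 0 2) + Complex.normSq (A 1 2) : ℝ) : ℂ)
        = ((Complex.normSq (A 2 0) + Complex.normSq (A 2 1) : ℝ) : ℂ) := by
        push_cast
        simp only [← Complex.mul_conj]
        linear_combination h22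
      exact_mod_cast this
    have n1 := Complex.normSq_nonneg (A 0 2)
    have n2 := Complex.normSq_nonneg (A 1 2)
    have n3 := Complex.normSq_nonneg (A 2 0)
    have n4 := Complex.normSq_nonneg (A 2 1)
    have : (Complex.normSq (A 0 2) - Complex.normSq (A 2 1)) *
      (Complex.normSq (A 0 2) + Complex.normSq (A 1 2)) = 0 := by
      linear_combination hy + Complex.normSq (A 0 2) * hz
    rcases mul_eq_zero.mp this with h | h <;> linarith
  obtain ⟨t, ht, hp⟩ := exists_phase (A 0 2) (A 2 1) (by
    have : ((Complex.normSq (A 0 2) : ℝ) : ℂ) = (Complex.normSq (A 2 1) : ℝ) := by rw [ns]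
    simp only [← Complex.mul_conj] at this
    simp only [Complex.star_def]
    linear_combination this)
  have hr : ((Real.sqrt l : ℝ) : ℂ) * ((Real.sqrt l : ℝ) : ℂ) = l := by
    exact_mod_cast Real.mul_self_sqrt hl.le
  simp only [Complex.star_def] at ht hp
  refine ⟨Matrix.of fun i _ => ![((Real.sqrt l : ℝ) : ℂ), 0, 0] i,
    Matrix.of fun i _ => ![0, (Real.sqrt l : ℝ) * t, 0] i,
    A 0 0 - star (t * A 0 1), ?_, ?_, ?_⟩
  · rw [h]
    ext i j
    fin_cases i <;> fin_cases j <;> simp [Matrix.mul_apply, hr]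
    linear_combination -hr - (Real.sqrt l : ℂ) * (Real.sqrt l : ℂ) * ht
  · ext i j
    fin_cases i <;> fin_cases j <;> simp [Matrix.mul_apply, Fin.sum_univ_three]
    · ring
    · linear_combination (Real.sqrt l : ℂ) * t * x
        - (Real.sqrt l : ℂ) * (starRingEnd ℂ) (A 0 1) * ht
    · linear_combination (Real.sqrt l : ℂ) * hp
  · ext i j
    fin_cases i <;> fin_cases j
    simp [Matrix.mul_apply, Fin.sum_univ_three]
    linear_combination - (Real.sqrt l : ℂ) * (Real.sqrt l : ℂ) * ht

lemma exists_order (e : Fin 3 → ℝ) (hs : e 0 + e 1 + e 2 = 0) (h0 : ∃ k, e k = 0)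
    (h1 : ∃ k, e k ≠ 0) :
    ∃ f : Fin 3 → Fin 3, Function.Injective f ∧ 0 < e (f 0) ∧ e (f 1) = - e (f 0) ∧
      e (f 2) = 0 := by
  have main : ∀ i j k : Fin 3, i ≠ j → i ≠ k → j ≠ k → e i + e j + e k = 0 → e k = 0 →
      ∃ f : Fin 3 → Fin 3, Function.Injective f ∧ 0 < e (f 0) ∧ e (f 1) = - e (f 0) ∧
      e (f 2) = 0 := by
    intro i j k hij hik hjk hsum hk
    have inj : ∀ i j k : Fin 3, i ≠ j → i ≠ k → j ≠ k →
        Function.Injective ![i, j, k] := by decide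
    rcases lt_trichotomy (e i) 0 with h | h | h
    · exact ⟨![j, i, k], inj j i k hij.symm hjk hik, by simp; linarith,
        by simp; linarith, by simpa using hk⟩
    · exfalso
      obtain ⟨m, hm⟩ := h1
      have hj : e j = 0 := by linarith
      have : m = i ∨ m = j ∨ m = k := by
        clear hj h hk hsum hm
        revert i j k m; decide
      rcases this with rfl | rfl | rfl <;> exact hm (by assumption)
    · exact ⟨![i, j, k], inj i j k hij hik hjk, by simpa using h,
        by simp; linarith, by simpa using hk⟩
  obtain ⟨k, hk⟩ := h0
  fin_cases k
  · exact main 1 2 0 (by decide) (by decide) (by decide) (by linarith) hk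
  · exact main 0 2 1 (by decide) (by decide) (by decide) (by linarith) hk
  · exact main 0 1 2 (by decide) (by decide) (by decide) (by linarith) hk

/-- Unitary diagonalisation in the form we need. -/
lemma exists_diag (X : Matrix (Fin 3) (Fin 3) ℂ) (hX : X.IsHermitian) :
    ∃ U : Matrix (Fin 3) (Fin 3) ℂ, Uᴴ * U = 1 ∧
      Uᴴ * X * U = diagonal (fun i => (hX.eigenvalues i : ℂ)) := by
  refine ⟨hX.eigenvectorUnitary, ?_, ?_⟩
  · exact Unitary.coe_star_mul_self hX.eigenvectorUnitary
  · have := hX.conjStarAlgAut_star_eigenvectorUnitary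
    rw [Unitary.conjStarAlgAut_star_apply] at this
    exact this

lemma conj_comm (A U : Matrix (Fin 3) (Fin 3) ℂ) (hU : Uᴴ * U = 1) :
    (Uᴴ * A * U)ᴴ * (Uᴴ * A * U) - (Uᴴ * A * U) * (Uᴴ * A * U)ᴴ
      = Uᴴ * (Aᴴ * A - A * Aᴴ) * U := by
  have hU' : U * Uᴴ = 1 := mul_eq_one_comm.mp hU
  have e1 : (Uᴴ * A * U)ᴴ * (Uᴴ * A * U) = Uᴴ * (Aᴴ * A) * U := by
    simp only [conjTranspose_mul, conjTranspose_conjTranspose]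
    calc _ = Uᴴ * Aᴴ * (U * Uᴴ) * A * U := by simp only [Matrix.mul_assoc]
      _ = _ := by rw [hU']; simp [Matrix.mul_assoc]
  have e2 : (Uᴴ * A * U) * (Uᴴ * A * U)ᴴ = Uᴴ * (A * Aᴴ) * U := by
    simp only [conjTranspose_mul, conjTranspose_conjTranspose]
    calc _ = Uᴴ * A * (U * Uᴴ) * Aᴴ * U := by simp only [Matrix.mul_assoc]
      _ = _ := by rw [hU']; simp [Matrix.mul_assoc]
  rw [e1, e2, Matrix.mul_sub, Matrix.sub_mul]

lemma sum_eig (A : Matrix (Fin 3) (Fin 3) ℂ) (hX : (Aᴴ * A - A * Aᴴ).IsHermitian) :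
    hX.eigenvalues 0 + hX.eigenvalues 1 + hX.eigenvalues 2 = 0 := by
  have h := hX.trace_eq_sum_eigenvalues
  rw [trace_sub, Matrix.trace_mul_comm, sub_self, Fin.sum_univ_three] at h
  have : ((hX.eigenvalues 0 + hX.eigenvalues 1 + hX.eigenvalues 2 : ℝ) : ℂ) = 0 := by
    push_cast; exact h.symm
  exact_mod_cast this

lemma bord_of_zero (A : Matrix (Fin 3) (Fin 3) ℂ) (hX : (Aᴴ * A - A * Aᴴ).IsHermitian)
    (h0 : ∃ k, hX.eigenvalues k = 0) (h1 : ∃ k, hX.eigenvalues k ≠ 0) : Bord A := by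
  obtain ⟨f, hf, f0, f1, f2⟩ := exists_order _ (sum_eig A hX) h0 h1
  obtain ⟨U, hU, hD⟩ := exists_diag _ hX
  have hV : (U.submatrix id f)ᴴ * (U.submatrix id f) = 1 := by
    rw [conjTranspose_submatrix, ← submatrix_mul _ _ _ _ _ Function.bijective_id, hU,
      submatrix_one _ hf]
  apply Bord.conj hV
  apply bord_diag _ _ f0
  rw [conj_comm _ _ hV]
  have : (U.submatrix id f)ᴴ * (Aᴴ * A - A * Aᴴ) * (U.submatrix id f)
      = (Uᴴ * (Aᴴ * A - A * Aᴴ) * U).submatrix f f := by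
    rw [submatrix_mul _ _ _ id _ Function.bijective_id,
      submatrix_mul _ _ _ id _ Function.bijective_id, conjTranspose_submatrix, submatrix_id_id]
  rw [this, hD, submatrix_diagonal _ _ hf]
  congr 1
  funext i
  fin_cases i
  · simp
  · simp [f1]
  · simp [f2]

open scoped ComplexOrder in
/-- Every 3×3 matrix has a normal completion of size 5 (a multiple of a unitary). -/
lemma completion_two (A : Matrix (Fin 3) (Fin 3) ℂ) :
    ∃ B : Matrix (Fin (3 + 2)) (Fin (3 + 2)) ℂ, Bᴴ * B = B * Bᴴ ∧
        ∀ i j : Fin 3, B (Fin.castLE (Nat.le_add_right 3 2) i)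
          (Fin.castLE (Nat.le_add_right 3 2) j) = A i j := by
  have hH : (Aᴴ * A).IsHermitian := isHermitian_conjTranspose_mul_self A
  have hpsd : (Aᴴ * A).PosSemidef := posSemidef_conjTranspose_mul_self A
  obtain ⟨U, hU, hD⟩ := exists_diag _ hH
  have hU' : U * Uᴴ = 1 := mul_eq_one_comm.mp hU
  obtain ⟨m, hm⟩ := Finite.exists_max hH.eigenvalues
  set e := hH.eigenvalues with he
  have hD' : Aᴴ * A = U * diagonal (fun i => (e i : ℂ)) * Uᴴ := by
    rw [← hD]
    calc Aᴴ * A = (U * Uᴴ) * (Aᴴ * A) * (U * Uᴴ) := by rw [hU']; simp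
      _ = _ := by simp only [Matrix.mul_assoc]
  have hm0 : 0 ≤ e m := hpsd.eigenvalues_nonneg m
  rcases hm0.eq_or_lt with hz | hpos
  · refine ⟨0, by simp, ?_⟩
    have : (fun i => (e i : ℂ)) = 0 := by
      funext i
      have h1 := hm i
      have h2 : 0 ≤ e i := hpsd.eigenvalues_nonneg i
      have : e i = 0 := by linarith
      simp [this]
    rw [this] at hD'
    have hA : Aᴴ * A = 0 := by
      rw [hD']
      have : diagonal (0 : Fin 3 → ℂ) = 0 := by ext i j; simp [diagonal_apply]
      rw [this]; simp
    have := conjTranspose_mul_self_eq_zero.mp hA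
    simp [this]
  · -- the bottom block
    let D : Matrix (Fin 2) (Fin 3) ℂ := Matrix.of fun k i =>
      if m.succAbove k = i then ((Real.sqrt (e m - e i) : ℝ) : ℂ) else 0
    have hDD : Dᴴ * D = diagonal (fun i => ((e m - e i : ℝ) : ℂ)) := by
      have hsq : ∀ i, ((Real.sqrt (e m - e i) : ℝ) : ℂ) * ((Real.sqrt (e m - e i) : ℝ) : ℂ)
          = ((e m - e i : ℝ) : ℂ) := fun i => by
        exact_mod_cast Real.mul_self_sqrt (sub_nonneg.mpr (hm i))
      ext i j
      rw [Matrix.mul_apply]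
      simp only [conjTranspose_apply, D, Matrix.of_apply, diagonal_apply]
      by_cases hij : i = j
      · subst hij
        rw [if_pos rfl]
        by_cases hi : i = m
        · subst hi; simp
        · obtain ⟨k, rfl⟩ := Fin.exists_succAbove_eq hi
          rw [Finset.sum_eq_single k]
          · simp [-Complex.ofReal_sub, hsq]
          · intro b _ hb
            simp [hb]
          · simp
      · rw [if_neg hij]
        apply Finset.sum_eq_zero
        intro k _
        by_cases h1 : m.succAbove k = i
        · have : m.succAbove k ≠ j := fun h => hij (h1 ▸ h)
          simp [this]
        · simp [h1]
    let C : Matrix (Fin 2) (Fin 3) ℂ := D * Uᴴ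
    have hCC : Aᴴ * A + Cᴴ * C = (e m : ℂ) • (1 : Matrix (Fin 3) (Fin 3) ℂ) := by
      have h1 : Cᴴ * C = U * (Dᴴ * D) * Uᴴ := by
        simp only [C, conjTranspose_mul, conjTranspose_conjTranspose, Matrix.mul_assoc]
      rw [h1, hDD, hD', ← Matrix.add_mul, ← Matrix.mul_add, diagonal_add]
      have : diagonal (fun i => (e i : ℂ) + ((e m - e i : ℝ) : ℂ))
          = (e m : ℂ) • (1 : Matrix (Fin 3) (Fin 3) ℂ) := by
        rw [smul_one_eq_diagonal]
        congr 1
        funext i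
        push_cast; ring
      rw [this]
      simp [hU']
    set s : ℝ := Real.sqrt (e m) with hs
    have hs0 : 0 < s := Real.sqrt_pos.mpr hpos
    have hss : (s : ℂ) * s = e m := by exact_mod_cast Real.mul_self_sqrt hm0
    have hsne : (s : ℂ) ≠ 0 := by exact_mod_cast hs0.ne'
    let v : Fin 3 ⊕ Fin 2 → EuclideanSpace ℂ (Fin 3 ⊕ Fin 2) := fun j =>
      WithLp.toLp 2 (Sum.elim
        (fun j' => fun i => (s : ℂ)⁻¹ * Sum.elim (fun i' => A i' j') (fun k => C k j') i)
        (fun _ => 0) j)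
    have hv : Orthonormal ℂ ((Set.range (Sum.inl : Fin 3 → Fin 3 ⊕ Fin 2)).domRestrict v) := by
      rw [orthonormal_iff_ite]
      rintro ⟨_, i, rfl⟩ ⟨_, j, rfl⟩
      have hij := congrFun (congrFun hCC i) j
      simp only [Matrix.add_apply, Matrix.mul_apply, conjTranspose_apply, Matrix.smul_apply,
        Matrix.one_apply] at hij
      have v1 : ∀ i j, v (Sum.inl j) (Sum.inl i) = (s : ℂ)⁻¹ * A i j := fun _ _ => rfl
      have v2 : ∀ k j, v (Sum.inl j) (Sum.inr k) = (s : ℂ)⁻¹ * C k j := fun _ _ => rfl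
      simp only [Set.domRestrict_apply, PiLp.inner_apply, Fintype.sum_sum_type,
        RCLike.inner_apply, v1, v2, map_mul, map_inv₀,
        Complex.conj_ofReal]
      have g : ∀ x y : ℂ, (s : ℂ)⁻¹ * y * ((s : ℂ)⁻¹ * (starRingEnd ℂ) x)
          = (e m : ℂ)⁻¹ * (star x * y) := fun x y => by
        rw [← hss, mul_inv, Complex.star_def]; ring
      simp only [g, ← Finset.mul_sum, ← mul_add]
      rw [hij]
      have : (e m : ℂ) ≠ 0 := by exact_mod_cast hpos.ne'
      by_cases hij' : i = j
      · subst hij'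
        simp [this]
      · split_ifs with h
        · exact absurd (Sum.inl.inj (congrArg Subtype.val h)) hij'
        · simp
    obtain ⟨b, hb⟩ := hv.exists_orthonormalBasis_extension_of_card_eq (by simp)
    let N : Matrix (Fin 3 ⊕ Fin 2) (Fin 3 ⊕ Fin 2) ℂ := Matrix.of fun i j => b j i
    have hN : Nᴴ * N = 1 := by
      ext i j
      have := orthonormal_iff_ite.mp b.orthonormal i j
      rw [PiLp.inner_apply] at this
      rw [Matrix.mul_apply, Matrix.one_apply, ← this]
      apply Finset.sum_congr rfl
      intro k _
      simp [N, mul_comm]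
    have hN' : N * Nᴴ = 1 := mul_eq_one_comm.mp hN
    refine completion_of_blocks A ((s : ℂ) • N) ?_ ?_
    · rw [conjTranspose_smul, Matrix.smul_mul, Matrix.mul_smul, Matrix.smul_mul,
        Matrix.mul_smul, hN, hN', smul_comm]
    · intro i j
      simp only [Matrix.smul_apply, N, Matrix.of_apply, hb (Sum.inl j) ⟨j, rfl⟩, v, Sum.elim_inl,
        smul_eq_mul]
      field_simp

lemma card_le_one_of_border (A : Matrix (Fin 3) (Fin 3) ℂ)
    (hX : (Aᴴ * A - A * Aᴴ).IsHermitian) (b c : Matrix (Fin 3) (Fin 1) ℂ)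
    (h : Aᴴ * A - A * Aᴴ = b * bᴴ - c * cᴴ) :
    (Finset.univ.filter fun i => 0 < hX.eigenvalues i).card ≤ 1 ∧
      (Finset.univ.filter fun i => hX.eigenvalues i < 0).card ≤ 1 := by
  obtain ⟨U, hU, hD⟩ := exists_diag _ hX
  set e := hX.eigenvalues
  have h' : diagonal (fun i => (e i : ℂ)) = (Uᴴ * b) * (Uᴴ * b)ᴴ - (Uᴴ * c) * (Uᴴ * c)ᴴ := by
    rw [← hD, h]
    simp only [Matrix.mul_sub, Matrix.sub_mul, conjTranspose_mul, conjTranspose_conjTranspose,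
      Matrix.mul_assoc]
  set x := Uᴴ * b
  set y := Uᴴ * c
  have hd : ∀ i, e i = Complex.normSq (x i 0) - Complex.normSq (y i 0) := fun i => by
    have := congrFun (congrFun h' i) i
    simp [Matrix.mul_apply, Complex.mul_conj] at this
    exact_mod_cast this
  have ho : ∀ i j, i ≠ j → Complex.normSq (x i 0) * Complex.normSq (x j 0)
      = Complex.normSq (y i 0) * Complex.normSq (y j 0) := fun i j hij => by
    have := congrFun (congrFun h' i) j
    simp [Matrix.mul_apply, hij] at this
    have := congrArg Complex.normSq (sub_eq_zero.mp this.symm)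
    simpa using this
  constructor
  · rw [Finset.card_le_one]
    intro i hi j hj
    by_contra hij
    have hi := (Finset.mem_filter.mp hi).2
    have hj := (Finset.mem_filter.mp hj).2
    have := ho i j hij
    have n1 := Complex.normSq_nonneg (y i 0)
    have n2 := Complex.normSq_nonneg (y j 0)
    rw [hd] at hi hj
    nlinarith
  · rw [Finset.card_le_one]
    intro i hi j hj
    by_contra hij
    have hi := (Finset.mem_filter.mp hi).2
    have hj := (Finset.mem_filter.mp hj).2
    have := ho i j hij
    have n1 := Complex.normSq_nonneg (x i 0)
    have n2 := Complex.normSq_nonneg (x j 0)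
    rw [hd] at hi hj
    nlinarith

lemma border_of_completion (A : Matrix (Fin 3) (Fin 3) ℂ)
    (B : Matrix (Fin (3 + 1)) (Fin (3 + 1)) ℂ) (hB : Bᴴ * B = B * Bᴴ)
    (hA : ∀ i j : Fin 3, B (Fin.castLE (Nat.le_add_right 3 1) i)
          (Fin.castLE (Nat.le_add_right 3 1) j) = A i j) :
    ∃ b c : Matrix (Fin 3) (Fin 1) ℂ, Aᴴ * A - A * Aᴴ = b * bᴴ - c * cᴴ := by
  refine ⟨Matrix.of fun i _ => B (Fin.castSucc i) (Fin.last 3),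
    Matrix.of fun i _ => star (B (Fin.last 3) (Fin.castSucc i)), ?_⟩
  ext i j
  have hA' : ∀ i j : Fin 3, B (Fin.castSucc i) (Fin.castSucc j) = A i j := hA
  have h := congrFun (congrFun hB (Fin.castSucc i)) (Fin.castSucc j)
  rw [Matrix.mul_apply, Matrix.mul_apply, Fin.sum_univ_castSucc (n := 3),
    Fin.sum_univ_castSucc (n := 3)] at h
  simp only [conjTranspose_apply, hA'] at h
  simp only [Matrix.sub_apply, Matrix.mul_apply, conjTranspose_apply, Finset.univ_unique,
    Finset.sum_singleton, Matrix.of_apply, star_star]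
  linear_combination h

end NormalDefect

open NormalDefect

theorem stmt9 (A : Matrix (Fin 3) (Fin 3) ℂ)
    (hX : (Aᴴ * A - A * Aᴴ).IsHermitian) :
    ((¬ Aᴴ * A = A * Aᴴ) → (Aᴴ * A - A * Aᴴ).rank = 2 →
      ∃ B : Matrix (Fin 4) (Fin 4) ℂ, Bᴴ * B = B * Bᴴ ∧
        ∀ i j : Fin 3, B (Fin.castLE (by norm_num) i) (Fin.castLE (by norm_num) j) = A i j) ∧
    sInf {p : ℕ | ∃ B : Matrix (Fin (3 + p)) (Fin (3 + p)) ℂ, Bᴴ * B = B * Bᴴ ∧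
        ∀ i j : Fin 3, B (Fin.castLE (Nat.le_add_right 3 p) i)
          (Fin.castLE (Nat.le_add_right 3 p) j) = A i j}
      = max (Finset.univ.filter fun i => 0 < hX.eigenvalues i).card
          (Finset.univ.filter fun i => hX.eigenvalues i < 0).card := by
  have hsum := sum_eig A hX
  have hne : Aᴴ * A ≠ A * Aᴴ → ∃ k, hX.eigenvalues k ≠ 0 := by
    intro h
    by_contra! hc
    exact h (sub_eq_zero.mp (hX.eigenvalues_eq_zero_iff.mp (funext hc)))
  have hnormal : Aᴴ * A = A * Aᴴ → ∀ k, hX.eigenvalues k = 0 := fun h k =>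
    congrFun (hX.eigenvalues_eq_zero_iff.mpr (sub_eq_zero.mpr h)) k
  constructor
  · intro h hr
    refine (bord_of_zero A hX ?_ (hne h)).completion
    by_contra! hc
    rw [hX.rank_eq_card_non_zero_eigs] at hr
    have : Fintype.card {i // hX.eigenvalues i ≠ 0} = 3 := by
      rw [Fintype.card_subtype, Finset.filter_true_of_mem (fun i _ => hc i)]
      simp
    omega
  · by_cases hn : Aᴴ * A = A * Aᴴ
    · have hz := hnormal hn
      simp only [hz, lt_irrefl, Finset.filter_false, Finset.card_empty, max_self]
      rw [Nat.sInf_eq_zero]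
      left
      exact ⟨A, hn, fun i j => rfl⟩
    · obtain ⟨k, hk⟩ := hne hn
      set P := (Finset.univ.filter fun i => 0 < hX.eigenvalues i).card with hP
      set Q := (Finset.univ.filter fun i => hX.eigenvalues i < 0).card with hQ
      have hP2 : P ≤ 2 := by
        by_contra! hc
        have : (Finset.univ.filter fun i => 0 < hX.eigenvalues i) = Finset.univ := by
          apply Finset.eq_univ_of_card
          have := Finset.card_le_univ (Finset.univ.filter fun i => 0 < hX.eigenvalues i)
          simp only [Fintype.card_fin] at this ⊢
          omega
        have h : ∀ i, 0 < hX.eigenvalues i := by simpa using this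
        linarith [h 0, h 1, h 2]
      have hQ2 : Q ≤ 2 := by
        by_contra! hc
        have : (Finset.univ.filter fun i => hX.eigenvalues i < 0) = Finset.univ := by
          apply Finset.eq_univ_of_card
          have := Finset.card_le_univ (Finset.univ.filter fun i => hX.eigenvalues i < 0)
          simp only [Fintype.card_fin] at this ⊢
          omega
        have h : ∀ i, hX.eigenvalues i < 0 := by simpa using this
        linarith [h 0, h 1, h 2]
      have hM1 : 1 ≤ max P Q := by
        rcases lt_or_gt_of_ne hk with h | h
        · exact le_max_of_le_right (Finset.card_pos.mpr ⟨k, by simpa using h⟩)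
        · exact le_max_of_le_left (Finset.card_pos.mpr ⟨k, by simpa using h⟩)
      apply le_antisymm
      · apply Nat.sInf_le
        have hM : max P Q = 1 ∨ max P Q = 2 := by omega
        rcases hM with hM | hM
        · rw [hM]
          refine (bord_of_zero A hX ?_ ⟨k, hk⟩).completion
          by_contra! hc
          have hu : (Finset.univ.filter fun i => 0 < hX.eigenvalues i) ∪
              (Finset.univ.filter fun i => hX.eigenvalues i < 0) = Finset.univ := by
            ext i
            have := (lt_or_gt_of_ne (hc i)).symm
            simpa using this
          have := Finset.card_union_le (Finset.univ.filter fun i => 0 < hX.eigenvalues i)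
              (Finset.univ.filter fun i => hX.eigenvalues i < 0)
          rw [hu, Finset.card_univ, Fintype.card_fin] at this
          omega
        · rw [hM]
          exact completion_two A
      · apply le_csInf ⟨2, completion_two A⟩
        rintro p ⟨B, hB, hBA⟩
        rcases p with _ | _ | p
        · exfalso
          apply hn
          have : B = A := by ext i j; exact hBA i j
          subst this
          exact hB
        · obtain ⟨b, c, h⟩ := border_of_completion A B hB hBA
          obtain ⟨h1, h2⟩ := card_le_one_of_border A hX b c h
          exact max_le h1 h2
        · omega
end

section
/- For a real matrix A ∈ ℝ^{n×n}, A has a real normal completion of size (n+1)×(n+1) (with A not normal) if and only if A has a complex normal completion of size (n+1)×(n+1); i.e., rnd(A) = 1 if and only if nd(A) = 1. -/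
open Matrix

/-- A nonzero difference of rank-one Hermitian forms with trace zero: dual functionals exist. -/
lemma exists_dual {n : ℕ} (x y : Fin n → ℂ) (p q : Fin n)
    (hne : x p * star (x q) - y p * star (y q) ≠ 0)
    (htr : ∑ i, star (x i) * x i = ∑ i, star (y i) * y i) :
    ∃ f g : Fin n → ℂ, ∑ i, f i * x i = 1 ∧ ∑ i, f i * y i = 0 ∧
      ∑ i, g i * x i = 0 ∧ ∑ i, g i * y i = 1 := by
  obtain ⟨N, hN⟩ : ∃ N, N = ∑ i, star (x i) * x i := ⟨_, rfl⟩
  obtain ⟨t, ht⟩ : ∃ t, t = ∑ i, star (y i) * x i := ⟨_, rfl⟩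
  have hN2 : ∑ i, star (y i) * y i = N := by rw [hN, htr]
  have ht2 : ∑ i, star (x i) * y i = star t := by
    rw [ht, star_sum]; exact Finset.sum_congr rfl fun i _ => by simp [mul_comm]
  have hD : N * N - t * star t ≠ 0 := by
    intro h0
    have key : ∑ i, ∑ j, (x i * star (x j) - y i * star (y j)) *
        star (x i * star (x j) - y i * star (y j)) = 2 * (N * N - t * star t) := by
      have e : ∀ i j, (x i * star (x j) - y i * star (y j)) *
        star (x i * star (x j) - y i * star (y j)) =
          (star (x i) * x i) * (star (x j) * x j) - (star (y i) * x i) * (star (x j) * y j)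
          - (star (x i) * y i) * (star (y j) * x j) + (star (y i) * y i) * (star (y j) * y j) := by
        intro i j
        simp only [star_sub, star_mul, star_star]; ring
      simp only [e, Finset.sum_add_distrib, Finset.sum_sub_distrib, ← Finset.mul_sum,
        ← Finset.sum_mul, hN2, ht2, ← hN, ← ht]
      ring
    rw [h0, mul_zero] at key
    have key2 : ∑ i, ∑ j, Complex.normSq (x i * star (x j) - y i * star (y j)) = 0 := by
      have : ((∑ i, ∑ j, Complex.normSq (x i * star (x j) - y i * star (y j)) : ℝ) : ℂ) = 0 := by
        rw [← key]; push_cast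
        refine Finset.sum_congr rfl fun i _ => Finset.sum_congr rfl fun j _ => ?_
        rw [Complex.normSq_eq_conj_mul_self, mul_comm]; rfl
      exact_mod_cast this
    rw [Finset.sum_eq_zero_iff_of_nonneg
      (fun i _ => Finset.sum_nonneg fun j _ => Complex.normSq_nonneg _)] at key2
    have k3 := key2 p (Finset.mem_univ _)
    rw [Finset.sum_eq_zero_iff_of_nonneg (fun j _ => Complex.normSq_nonneg _)] at k3
    exact hne (Complex.normSq_eq_zero.1 (k3 q (Finset.mem_univ _)))
  have lin : ∀ (a b : ℂ) (w : Fin n → ℂ), ∑ i, (a * star (x i) + b * star (y i)) * w i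
      = a * ∑ i, star (x i) * w i + b * ∑ i, star (y i) * w i := by
    intro a b w
    rw [Finset.mul_sum, Finset.mul_sum, ← Finset.sum_add_distrib]
    exact Finset.sum_congr rfl fun i _ => by ring
  obtain ⟨D, hDd⟩ : ∃ D, D = N * N - t * star t := ⟨_, rfl⟩
  rw [← hDd] at hD
  refine ⟨fun i => N / D * star (x i) + (-star t / D) * star (y i),
    fun i => (-t / D) * star (x i) + N / D * star (y i), ?_, ?_, ?_, ?_⟩ <;>
  · rw [lin]
    simp only [hN2, ht2, ← hN, ← ht]
    field_simp
    first
      | linear_combination -hDd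
      | ring

/-- Structure relations between `x`, `y` and their conjugates. -/
lemma exists_coeff {n : ℕ} (x y : Fin n → ℂ) (f g : Fin n → ℂ)
    (hreal : ∀ i j, x i * star (x j) - y i * star (y j) = star (x i) * x j - star (y i) * y j)
    (hfx : ∑ i, f i * x i = 1) (hfy : ∑ i, f i * y i = 0)
    (hgx : ∑ i, g i * x i = 0) (hgy : ∑ i, g i * y i = 1) :
    ∃ α β δ : ℂ, (∀ i, star (x i) = α * x i + β * y i) ∧
      (∀ i, star (y i) = -β * x i + δ * y i) ∧
      star α * α - star β * β = 1 ∧ star δ * δ - star β * β = 1 ∧ star α * β + star β * δ = 0 := by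
  have ind : ∀ a b c d : ℂ, (∀ i, a * x i + b * y i = c * x i + d * y i) → a = c ∧ b = d := by
    intro a b c d h
    have aux : ∀ w : Fin n → ℂ, a * ∑ i, w i * x i + b * ∑ i, w i * y i
        = c * ∑ i, w i * x i + d * ∑ i, w i * y i := by
      intro w
      simp only [Finset.mul_sum, ← Finset.sum_add_distrib]
      exact Finset.sum_congr rfl fun i _ => by linear_combination w i * h i
    have h1 := aux f
    have h2 := aux g
    rw [hfx, hfy] at h1
    rw [hgx, hgy] at h2
    constructor
    · linear_combination h1
    · linear_combination h2
  have gen : ∀ (w : Fin n → ℂ) i, x i * (∑ j, w j * star (x j)) - y i * (∑ j, w j * star (y j))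
      = star (x i) * (∑ j, w j * x j) - star (y i) * (∑ j, w j * y j) := by
    intro w i
    simp only [Finset.mul_sum, ← Finset.sum_sub_distrib]
    exact Finset.sum_congr rfl fun j _ => by linear_combination w j * hreal i j
  obtain ⟨α, hα⟩ : ∃ a, a = ∑ j, f j * star (x j) := ⟨_, rfl⟩
  obtain ⟨β, hβ⟩ : ∃ a, a = -∑ j, f j * star (y j) := ⟨_, rfl⟩
  obtain ⟨γ, hγ⟩ : ∃ a, a = -∑ j, g j * star (x j) := ⟨_, rfl⟩
  obtain ⟨δ, hδ⟩ : ∃ a, a = ∑ j, g j * star (y j) := ⟨_, rfl⟩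
  have hx : ∀ i, star (x i) = α * x i + β * y i := by
    intro i
    have := gen f i
    rw [hfx, hfy] at this
    rw [hα, hβ]; linear_combination -this
  have hy' : ∀ i, star (y i) = γ * x i + δ * y i := by
    intro i
    have := gen g i
    rw [hgx, hgy] at this
    rw [hγ, hδ]; linear_combination this
  have hγβ : γ = -β := by
    have : ∀ j, star (x j) = α * x j + (-γ) * y j := by
      intro j
      refine (ind _ (-star (y j)) _ (β * x j - δ * y j) fun i => ?_).1
      linear_combination hreal i j + x j * hx i - y j * hy' i
    have := (ind α β α (-γ) fun i => by rw [← hx, this]).2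
    rw [this]; ring
  have hy : ∀ i, star (y i) = -β * x i + δ * y i := by rw [← hγβ]; exact hy'
  have hxx : ∀ i, x i = star α * star (x i) + star β * star (y i) := by
    intro i
    have := congrArg star (hx i)
    simp only [star_add, star_mul, star_star] at this
    linear_combination this
  have hyy : ∀ i, y i = -star β * star (x i) + star δ * star (y i) := by
    intro i
    have := congrArg star (hy i)
    simp only [star_add, star_mul, star_star, star_neg] at this
    linear_combination this
  have r1 := ind 1 0 (star α * α - star β * β) (star α * β + star β * δ) fun i => by
    linear_combination hxx i + star α * hx i + star β * hy i
  have r2 := ind 0 1 (-star β * α - star δ * β) (star δ * δ - star β * β) fun i => by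
    linear_combination hyy i - star β * hx i + star δ * hy i
  exact ⟨α, β, δ, hx, hy, r1.1.symm, r2.2.symm, r1.2.symm⟩

/-- Existence of the normalising phase. -/
lemma exists_phase (α β δ : ℂ) (h1 : star α * α - star β * β = 1)
    (h2 : star δ * δ - star β * β = 1) (h3 : star α * β + star β * δ = 0) :
    ∃ w : ℂ, star w * w = 1 ∧ star w ^ 2 * δ = star (star w ^ 2 * α) ∧
      star w ^ 2 * β + star (star w ^ 2 * β) = 0 ∧ 0 ≤ (star w ^ 2 * α).re := by
  have hα : star α ≠ 0 := by
    intro h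
    have hb : (Complex.normSq β : ℂ) = -1 := by
      rw [Complex.normSq_eq_conj_mul_self]
      change star β * β = -1
      rw [h] at h1; linear_combination -h1
    have hb' : Complex.normSq β = -1 := by exact_mod_cast hb
    linarith [Complex.normSq_nonneg β]
  have hα' : α ≠ 0 := by simpa using hα
  obtain ⟨w, hw⟩ := IsAlgClosed.exists_pow_nat_eq (δ / star α) (n := 4) (by norm_num)
  have hn : ‖w‖ = 1 := by
    have e1 : ‖δ‖ = ‖α‖ := by
      have e : (Complex.normSq δ : ℂ) = Complex.normSq α := by
        rw [Complex.normSq_eq_conj_mul_self, Complex.normSq_eq_conj_mul_self]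
        change star δ * δ = star α * α
        linear_combination h2 - h1
      have e' : Complex.normSq δ = Complex.normSq α := by exact_mod_cast e
      rw [Complex.normSq_eq_norm_sq, Complex.normSq_eq_norm_sq] at e'
      exact (sq_eq_sq₀ (norm_nonneg _) (norm_nonneg _)).1 e'
    have : ‖w‖ ^ 4 = 1 := by
      rw [← norm_pow, hw, norm_div, norm_star, e1, div_self (by simpa using hα')]
    exact (pow_eq_one_iff_of_nonneg (norm_nonneg _) (by norm_num)).1 this
  have hww : star w * w = 1 := by
    have := Complex.normSq_eq_conj_mul_self (z := w)
    rw [Complex.normSq_eq_norm_sq, hn] at this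
    change _ = star w * w at this
    rw [← this]; simp
  have hδ : δ = w ^ 4 * star α := by rw [hw]; field_simp
  have key : ∀ v : ℂ, star v * v = 1 → δ = v ^ 4 * star α →
      star v ^ 2 * δ = star (star v ^ 2 * α) ∧ star v ^ 2 * β + star (star v ^ 2 * β) = 0 := by
    intro v hv hd
    constructor
    · simp only [star_mul, star_pow, star_star]
      rw [hd]
      linear_combination (v ^ 2 * star α) * (star v * v + 1) * hv
    · simp only [star_mul, star_pow, star_star]
      have : star α * (star v ^ 2 * β + star β * v ^ 2) = 0 := by
        rw [hd] at h3
        linear_combination star v ^ 2 * h3 - star β * v ^ 2 * star α * (star v * v + 1) * hv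
      exact (mul_eq_zero.1 this).resolve_left hα
  by_cases hre : 0 ≤ (star w ^ 2 * α).re
  · exact ⟨w, hww, (key w hww hδ).1, (key w hww hδ).2, hre⟩
  · have hI : star (Complex.I * w) * (Complex.I * w) = 1 := by
      have : star Complex.I = -Complex.I := Complex.conj_I
      rw [star_mul, this]
      linear_combination hww - (star w * w) * Complex.I_sq
    have hI4 : δ = (Complex.I * w) ^ 4 * star α := by
      rw [mul_pow, Complex.I_pow_four, one_mul]; exact hδ
    refine ⟨Complex.I * w, hI, (key _ hI hI4).1, (key _ hI hI4).2, ?_⟩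
    have e : star (Complex.I * w) ^ 2 * α = -(star w ^ 2 * α) := by
      have : star Complex.I = -Complex.I := Complex.conj_I
      rw [star_mul, this]
      linear_combination (star w ^ 2 * α) * Complex.I_sq
    rw [e, Complex.neg_re]
    linarith

/-- Real parts of a normalised pair. -/
lemma real_parts {n : ℕ} (x y : Fin n → ℂ) (α β : ℂ)
    (hx : ∀ i, star (x i) = α * x i + β * y i)
    (hy : ∀ i, star (y i) = -β * x i + star α * y i)
    (h1 : star α * α - star β * β = 1) (h2 : β + star β = 0) (h3 : 0 ≤ α.re) :
    (∀ i j, (x i).re * (x j).re - (y i).re * (y j).re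
      = (1 + α.re) / 2 * (x i * star (x j) - y i * star (y j)).re) ∧
    ∃ k : ℝ, ∀ i, (y i).im + (x i).im = k * ((y i).re - (x i).re) := by
  have re2 : ∀ z : ℂ, ((z.re : ℝ) : ℂ) = (z + star z) / 2 := fun z => Complex.re_eq_add_conj z
  have im2 : ∀ z : ℂ, Complex.I * ((z.im : ℝ) : ℂ) = (z - star z) / 2 := by
    intro z
    have : star z = (z.re : ℂ) - z.im * Complex.I := by
      apply Complex.ext <;> simp
    have h' := Complex.re_add_im z
    rw [this]; linear_combination (1 / 2 : ℂ) * h'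
  have hb : star β = -β := by linear_combination h2
  rw [hb] at h1
  have hxx : ∀ i, x i = star α * star (x i) - β * star (y i) := by
    intro i
    have := congrArg star (hx i)
    simp only [star_add, star_mul, star_star, hb] at this
    linear_combination this
  have hyy : ∀ i, y i = β * star (x i) + α * star (y i) := by
    intro i
    have := congrArg star (hy i)
    simp only [star_add, star_mul, star_star, star_neg, hb] at this
    linear_combination this
  constructor
  · intro i j
    have : (((x i).re * (x j).re - (y i).re * (y j).re : ℝ) : ℂ)
        = (((1 + α.re) / 2 : ℝ) : ℂ) * (x i * star (x j) - y i * star (y j)) := by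
      push_cast
      simp only [re2]
      have a1 : x i + star (x i) = (1 + α) * x i + β * y i := by rw [hx]; ring
      have a2 : y i + star (y i) = -β * x i + (1 + star α) * y i := by rw [hy]; ring
      have a3 : x j + star (x j) = (1 + star α) * star (x j) - β * star (y j) := by
        linear_combination hxx j
      have a4 : y j + star (y j) = β * star (x j) + (1 + α) * star (y j) := by
        linear_combination hyy j
      rw [a1, a2, a3, a4]
      linear_combination (1 / 4 : ℂ) * (x i * star (x j) - y i * star (y j)) * h1
    have h' := congrArg Complex.re this
    rw [Complex.re_ofReal_mul, Complex.ofReal_re] at h'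
    exact h'
  · have hP : -(1 + α + β) ≠ 0 := by
      intro h
      have hr := congrArg Complex.re h
      have hbr := congrArg Complex.re hb
      simp at hr hbr
      linarith
    refine ⟨((1 - α + β) / -(1 + α + β) * -Complex.I).re, fun i => ?_⟩
    have : (((y i).im + (x i).im : ℝ) : ℂ)
        = ((1 - α + β) / -(1 + α + β) * -Complex.I) * (((y i).re - (x i).re : ℝ) : ℂ) := by
      have hm : -(1 + α + β) * (Complex.I * (((y i).im + (x i).im : ℝ) : ℂ))
          = (1 - α + β) * (((y i).re - (x i).re : ℝ) : ℂ) := by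
        push_cast
        rw [mul_add, im2, im2, re2, re2, hx, hy]
        linear_combination (y i) * h1
      apply mul_left_cancel₀ (mul_ne_zero hP Complex.I_ne_zero)
      rw [mul_assoc, hm]
      have hq := div_mul_cancel₀ (1 - α + β) hP
      generalize (1 - α + β) / -(1 + α + β) = Q at hq ⊢
      linear_combination (1 - α + β) * (((y i).re - (x i).re : ℝ) : ℂ) * Complex.I_sq
        + Complex.I ^ 2 * (((y i).re - (x i).re : ℝ) : ℂ) * hq
    have h' := congrArg Complex.re this
    rw [Complex.re_mul_ofReal, Complex.ofReal_re] at h'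
    exact h'

theorem stmt14 (n : ℕ) (A : Matrix (Fin n) (Fin n) ℝ) :
    ((¬ Aᵀ * A = A * Aᵀ) ∧
      ∃ B : Matrix (Fin (n + 1)) (Fin (n + 1)) ℝ, Bᵀ * B = B * Bᵀ ∧
        ∀ i j : Fin n, B i.castSucc j.castSucc = A i j) ↔
    ((¬ Aᵀ * A = A * Aᵀ) ∧
      ∃ B : Matrix (Fin (n + 1)) (Fin (n + 1)) ℂ, Bᴴ * B = B * Bᴴ ∧
        ∀ i j : Fin n, B i.castSucc j.castSucc = (A i j : ℂ)) := by
  refine and_congr_right fun hA => ⟨?_, ?_⟩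
  · rintro ⟨B, hB, hBA⟩
    refine ⟨B.map (fun r : ℝ => (r : ℂ)), ?_, fun i j => by simp [hBA]⟩
    ext i j
    have := congrFun (congrFun hB i) j
    simp only [Matrix.mul_apply, Matrix.transpose_apply] at this
    simp only [Matrix.mul_apply, Matrix.conjTranspose_apply, Matrix.map_apply]
    have h' := congrArg (fun r : ℝ => (r : ℂ)) this
    push_cast at h'
    simpa using h'
  · rintro ⟨B, hB, hBA⟩
    obtain ⟨x, hx⟩ : ∃ x : Fin n → ℂ, ∀ i, B i.castSucc (Fin.last n) = x i := ⟨_, fun _ => rfl⟩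
    obtain ⟨y, hy⟩ : ∃ y : Fin n → ℂ, ∀ i, B (Fin.last n) i.castSucc = star (y i) :=
      ⟨fun i => star (B (Fin.last n) i.castSucc), fun _ => by simp⟩
    obtain ⟨z, hz⟩ : ∃ z : ℂ, B (Fin.last n) (Fin.last n) = z := ⟨_, rfl⟩
    have hent := fun i j => congrFun (congrFun hB i) j
    simp only [Matrix.mul_apply, Matrix.conjTranspose_apply, Fin.sum_univ_castSucc] at hent
    have hsr : ∀ r : ℝ, star (r : ℂ) = r := Complex.conj_ofReal
    have e11 : ∀ i j : Fin n, x i * star (x j) - y i * star (y j)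
        = ((∑ k, A k i * A k j - ∑ k, A i k * A j k : ℝ) : ℂ) := by
      intro i j
      have := hent i.castSucc j.castSucc
      simp only [hBA, hx, hy, hsr, star_star] at this
      push_cast
      linear_combination -this
    have e12 : ∀ i, ∑ k, (A i k : ℂ) * y k - ∑ k, (A k i : ℂ) * x k = z * y i - star z * x i := by
      intro i
      have := hent i.castSucc (Fin.last n)
      simp only [hBA, hx, hy, hz, hsr, star_star] at this
      linear_combination -this
    have e22 : ∑ i, star (x i) * x i = ∑ i, star (y i) * y i := by
      have := hent (Fin.last n) (Fin.last n)
      simp only [hx, hy, hz, star_star] at this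
      linear_combination this
    obtain ⟨p, q, hpq⟩ : ∃ p q, x p * star (x q) - y p * star (y q) ≠ 0 := by
      by_contra hcon
      push Not at hcon
      apply hA
      ext i j
      have h0 := (e11 i j).symm.trans (hcon i j)
      have h0' : (∑ k, A k i * A k j - ∑ k, A i k * A j k : ℝ) = 0 := by exact_mod_cast h0
      simp only [Matrix.mul_apply, Matrix.transpose_apply]
      linarith
    obtain ⟨f, g, hfx, hfy, hgx, hgy⟩ := exists_dual x y p q hpq e22
    have hreal : ∀ i j, x i * star (x j) - y i * star (y j)
        = star (x i) * x j - star (y i) * y j := by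
      intro i j
      have h' := congrArg star (e11 i j)
      rw [hsr, ← e11] at h'
      simp only [star_sub, star_mul, star_star] at h'
      linear_combination -h'
    obtain ⟨α, β, δ, hcx, hcy, r1, r2, r3⟩ := exists_coeff x y f g hreal hfx hfy hgx hgy
    obtain ⟨w, hw, w1, w2, w3⟩ := exists_phase α β δ r1 r2 r3
    -- rotate by the phase
    obtain ⟨x', hx'⟩ : ∃ x' : Fin n → ℂ, ∀ i, x' i = w * x i := ⟨_, fun _ => rfl⟩
    obtain ⟨y', hy'⟩ : ∃ y' : Fin n → ℂ, ∀ i, y' i = w * y i := ⟨_, fun _ => rfl⟩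
    have f11 : ∀ i j : Fin n, x' i * star (x' j) - y' i * star (y' j)
        = ((∑ k, A k i * A k j - ∑ k, A i k * A j k : ℝ) : ℂ) := by
      intro i j
      rw [← e11]
      simp only [hx', hy', star_mul]
      linear_combination (x i * star (x j) - y i * star (y j)) * hw
    have f12 : ∀ i, ∑ k, (A i k : ℂ) * y' k - ∑ k, (A k i : ℂ) * x' k
        = z * y' i - star z * x' i := by
      intro i
      have := congrArg (fun u => w * u) (e12 i)
      simp only [mul_sub, Finset.mul_sum] at this
      simp only [hx', hy', mul_left_comm _ w]
      exact this
    have hw2 : star w * w * (star w * w) = 1 := by rw [hw]; ring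
    obtain ⟨s1, k, s2⟩ := real_parts x' y' (star w ^ 2 * α) (star w ^ 2 * β)
      (by
        intro i
        simp only [hx', hy', star_mul]
        rw [hcx]
        linear_combination -(star w * (α * x i + β * y i)) * hw)
      (by
        intro i
        rw [← w1]
        simp only [hx', hy', star_mul]
        rw [hcy]
        linear_combination -(star w * (-β * x i + δ * y i)) * hw)
      (by
        simp only [star_mul, star_pow, star_star]
        linear_combination (star α * α - star β * β) * hw2 + r1)
      w2 w3
    obtain ⟨μ, hμ⟩ : ∃ μ, μ = (1 + (star w ^ 2 * α).re) / 2 := ⟨_, rfl⟩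
    have hμ0 : 0 < μ := by rw [hμ]; linarith
    rw [← hμ] at s1
    obtain ⟨c, hc⟩ : ∃ c : ℝ, c ^ 2 * μ = 1 := by
      refine ⟨(Real.sqrt μ)⁻¹, ?_⟩
      rw [inv_pow, Real.sq_sqrt hμ0.le, inv_mul_cancel₀ hμ0.ne']
    obtain ⟨X, hX⟩ : ∃ X : Fin n → ℝ, ∀ i, X i = c * (x' i).re := ⟨_, fun _ => rfl⟩
    obtain ⟨Y, hY⟩ : ∃ Y : Fin n → ℝ, ∀ i, Y i = c * (y' i).re := ⟨_, fun _ => rfl⟩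
    obtain ⟨ζ, hζ⟩ : ∃ ζ : ℝ, ζ = z.re - z.im * k := ⟨_, rfl⟩
    have g11 : ∀ i j : Fin n, X i * X j - Y i * Y j
        = ∑ k, A k i * A k j - ∑ k, A i k * A j k := by
      intro i j
      have h' := s1 i j
      rw [f11, Complex.ofReal_re] at h'
      rw [hX, hX, hY, hY]
      linear_combination c ^ 2 * h' + (∑ k, A k i * A k j - ∑ k, A i k * A j k) * hc
    have g12 : ∀ i, ∑ k, A i k * Y k - ∑ k, A k i * X k = ζ * (Y i - X i) := by
      intro i
      have h' := congrArg Complex.re (f12 i)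
      simp only [Complex.sub_re, Complex.re_sum, Complex.mul_re, Complex.ofReal_re,
        Complex.ofReal_im, zero_mul, sub_zero] at h'
      have hs1 : (star z).re = z.re := Complex.conj_re z
      have hs2 : (star z).im = -z.im := Complex.conj_im z
      rw [hs1, hs2] at h'
      simp only [hX, hY, hζ, mul_left_comm _ c, ← Finset.mul_sum]
      linear_combination c * h' - c * z.im * s2 i
    have g22 : ∑ i, X i * X i = ∑ i, Y i * Y i := by
      have h' : ∑ i, (X i * X i - Y i * Y i) = 0 := by
        simp only [g11, Finset.sum_sub_distrib]
        rw [Finset.sum_comm, sub_self]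
      rw [Finset.sum_sub_distrib] at h'
      linarith
    let M : Matrix (Fin (n + 1)) (Fin (n + 1)) ℝ := fun i j =>
      Fin.lastCases (motive := fun _ => ℝ)
        (Fin.lastCases (motive := fun _ => ℝ) ζ (fun j => Y j) j)
        (fun i => Fin.lastCases (motive := fun _ => ℝ) (X i) (fun j => A i j) j) i
    have m1 : ∀ i j : Fin n, M i.castSucc j.castSucc = A i j := fun i j => by simp [M]
    have m2 : ∀ i : Fin n, M i.castSucc (Fin.last n) = X i := fun i => by simp [M]
    have m3 : ∀ i : Fin n, M (Fin.last n) i.castSucc = Y i := fun i => by simp [M]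
    have m4 : M (Fin.last n) (Fin.last n) = ζ := by simp [M]
    refine ⟨M, ?_, m1⟩
    ext i j
    simp only [Matrix.mul_apply, Matrix.transpose_apply, Fin.sum_univ_castSucc]
    induction i using Fin.lastCases with
    | last =>
      induction j using Fin.lastCases with
      | last =>
        simp only [m2, m3, m4]
        linear_combination g22
      | cast j =>
        simp only [m1, m2, m3, m4]
        have h' := g12 j
        simp only [mul_comm (A _ _)] at h'
        linear_combination -h'
    | cast i =>
      induction j using Fin.lastCases with
      | last =>
        simp only [m1, m2, m3, m4]
        linear_combination -(g12 i)
      | cast j =>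
        simp only [m1, m2, m3]
        linear_combination -(g11 i j)
end
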